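/- With the convention Ξ(x) = −∞ whenever x ∈ X has at least one coordinate x_k = 0 (k ∈ K), the function Ξ is continuous on the entire set X (as a map into [−∞, 0]); consequently, for every δ_2 > 0 there exists δ_3 > 0 such that x ∈ X and L^{(a)}(x) − L^{(a)}(x^{*,a}) ≥ δ_2 imply Ξ(x) ≤ −δ_3. -/

import Mathlib

open scoped BigOperators
open Filter Topology

noncomputable section

variable {I S : Type} [Fintype I] [DecidableEq I] [Fintype S]

/-- The configuration `e_i` consisting of a single type-`i` customer. -/
def econf (i : I) : I → ℕ := Pi.single i 1

/-- `K^s`: the set of nonzero configurations of server type `s`. -/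
def Kc (Kbar : S → Finset (I → ℕ)) (s : S) : Finset (I → ℕ) := (Kbar s).erase 0

/-- Monotonicity of the configuration sets. -/
def KbarMono (Kbar : S → Finset (I → ℕ)) : Prop :=
  ∀ s, ∀ k ∈ Kbar s, ∀ k' : I → ℕ, (∀ i, k' i ≤ k i) → k' ∈ Kbar s

/-- Each configuration set contains the zero configuration. -/
def KbarZero (Kbar : S → Finset (I → ℕ)) : Prop := ∀ s, (0 : I → ℕ) ∈ Kbar s

/-- Every customer type can be served by some server type. -/
def KbarServe (Kbar : S → Finset (I → ℕ)) : Prop := ∀ i : I, ∃ s, econf i ∈ Kbar s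

/-- `ℝ_+^K`: nonnegative vectors supported on the nonzero configurations. -/
def orthK (Kbar : S → Finset (I → ℕ)) : Set (S → (I → ℕ) → ℝ) :=
  {x | (∀ s k, 0 ≤ x s k) ∧ ∀ s, ∀ k, k ∉ Kc Kbar s → x s k = 0}

/-- The feasible set `X` (equality constraints). -/
def feasX (Kbar : S → Finset (I → ℕ)) (ρ : I → ℝ) : Set (S → (I → ℕ) → ℝ) :=
  {x | x ∈ orthK Kbar ∧ ∀ i, ∑ s, ∑ k ∈ Kc Kbar s, (k i : ℝ) * x s k = ρ i}

/-- The relaxed feasible set (inequality constraints). -/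
def feasXge (Kbar : S → Finset (I → ℕ)) (ρ : I → ℝ) : Set (S → (I → ℕ) → ℝ) :=
  {x | x ∈ orthK Kbar ∧ ∀ i, ρ i ≤ ∑ s, ∑ k ∈ Kc Kbar s, (k i : ℝ) * x s k}

/-- The weighted number of occupied servers. -/
def objW (Kbar : S → Finset (I → ℕ)) (γ : S → ℝ) (x : S → (I → ℕ) → ℝ) : ℝ :=
  ∑ s, ∑ k ∈ Kc Kbar s, γ s * x s k

/-- `X*`: optimal solutions of LP=. -/
def XstarSet (Kbar : S → Finset (I → ℕ)) (ρ : I → ℝ) (γ : S → ℝ) :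
    Set (S → (I → ℕ) → ℝ) :=
  {x | x ∈ feasX Kbar ρ ∧ ∀ y ∈ feasX Kbar ρ, objW Kbar γ x ≤ objW Kbar γ y}

/-- `X**`: optimal solutions of LP≤. -/
def XstarSetGe (Kbar : S → Finset (I → ℕ)) (ρ : I → ℝ) (γ : S → ℝ) :
    Set (S → (I → ℕ) → ℝ) :=
  {x | x ∈ feasXge Kbar ρ ∧ ∀ y ∈ feasXge Kbar ρ, objW Kbar γ x ≤ objW Kbar γ y}

/-- `H*`: dual optimal vectors. -/
def HstarSet (Kbar : S → Finset (I → ℕ)) (ρ : I → ℝ) (γ : S → ℝ) : Set (I → ℝ) :=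
  {η | ∃ x ∈ feasX Kbar ρ, (∀ i, 0 ≤ η i) ∧
    (∀ s, ∀ k ∈ Kc Kbar s, ∑ i, (k i : ℝ) * η i ≤ γ s) ∧
    (∀ s, ∀ k ∈ Kc Kbar s, (∑ i, (k i : ℝ) * η i) < γ s → x s k = 0)}

/-- `c_k = ∏_i k_i!`. -/
def ck (k : I → ℕ) : ℝ := ∏ i, (Nat.factorial (k i) : ℝ)

/-- The function `L^{(a)}`. -/
def Lfun (Kbar : S → Finset (I → ℕ)) (a : S → ℝ) (x : S → (I → ℕ) → ℝ) : ℝ :=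
  ∑ s, ∑ k ∈ Kc Kbar s, x s k * Real.log (x s k * ck k / (Real.exp 1 * a s))

/-- Product form (infinite-server system). -/
def prodForm (Kbar : S → Finset (I → ℕ)) (a : S → ℝ) (x : S → (I → ℕ) → ℝ)
    (ν : I → ℝ) : Prop :=
  ∀ s, ∀ k ∈ Kc Kbar s, x s k = a s / ck k * Real.exp (∑ i, (k i : ℝ) * ν i)

/-- ℓ¹ distance on the coordinates indexed by `K`. -/
def distK (Kbar : S → Finset (I → ℕ)) (x y : S → (I → ℕ) → ℝ) : ℝ :=
  ∑ s, ∑ k ∈ Kc Kbar s, |x s k - y s k|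

/-- Extended coordinate value: the zero configuration of type `s` has value `a_s`. -/
def xval (a : S → ℝ) (x : S → (I → ℕ) → ℝ) (s : S) (k : I → ℕ) : ℝ :=
  if k = 0 then a s else x s k

/-- `x_{(i)}`: amount of servers available to a type-`i` arrival (GRAND(aZ)). -/
def xavail (Kbar : S → Finset (I → ℕ)) (a : S → ℝ) (x : S → (I → ℕ) → ℝ) (i : I) : ℝ :=
  ∑ s, ((if econf i ∈ Kc Kbar s then a s else 0)
    + ∑ k ∈ (Kc Kbar s).filter (fun k => k + econf i ∈ Kbar s), x s k)

/-- Departure rate `w_{k i}`. -/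
def wrate (μ : I → ℝ) (x : S → (I → ℕ) → ℝ) (s : S) (k : I → ℕ) (i : I) : ℝ :=
  (k i : ℝ) * μ i * x s k

/-- Arrival rate `v_{k i}` (GRAND(aZ)), with `λ_i = μ_i ρ_i`. -/
def vrate (Kbar : S → Finset (I → ℕ)) (a : S → ℝ) (μ ρ : I → ℝ)
    (x : S → (I → ℕ) → ℝ) (s : S) (k : I → ℕ) (i : I) : ℝ :=
  μ i * ρ i * xval a x s (k - econf i) / xavail Kbar a x i

/-- The GRAND(aZ) fluid vector field `F_k(x)`, for `k ∈ K^s`. -/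
def Fdrift (Kbar : S → Finset (I → ℕ)) (a : S → ℝ) (μ ρ : I → ℝ)
    (x : S → (I → ℕ) → ℝ) (s : S) (k : I → ℕ) : ℝ :=
  (∑ i ∈ Finset.univ.filter (fun i : I => 1 ≤ k i ∧ k - econf i ∈ Kbar s),
    (vrate Kbar a μ ρ x s k i - wrate μ x s k i))
  - ∑ i ∈ Finset.univ.filter (fun i : I => k + econf i ∈ Kbar s),
    (vrate Kbar a μ ρ x s (k + econf i) i - wrate μ x s (k + econf i) i)

/-- The function `Ξ(x)` (GRAND(aZ)). -/
def Xi (Kbar : S → Finset (I → ℕ)) (a : S → ℝ) (μ : I → ℝ)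
    (x : S → (I → ℕ) → ℝ) : ℝ :=
  ∑ i : I, ∑ s : S,
    ∑ k ∈ (Kc Kbar s).filter (fun k => 1 ≤ k i ∧ k - econf i ∈ Kbar s),
      ∑ s' : S,
        ∑ k' ∈ (Kc Kbar s').filter (fun k' => 1 ≤ k' i ∧ k' - econf i ∈ Kbar s'),
          (Real.log ((k' i : ℝ) * xval a x s (k - econf i) * x s' k')
            - Real.log ((k i : ℝ) * x s k * xval a x s' (k' - econf i)))
          * ((k i : ℝ) * μ i * x s k * xval a x s' (k' - econf i) / xavail Kbar a x i)

open Classical in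
/-- `Ξ` extended by `−∞` to points with a vanishing coordinate, as a map into `[−∞, 0] ⊆ EReal`. -/
def XiE (Kbar : S → Finset (I → ℕ)) (a : S → ℝ) (μ : I → ℝ)
    (x : S → (I → ℕ) → ℝ) : EReal :=
  if ∀ s, ∀ k ∈ Kc Kbar s, 0 < x s k then ((Xi Kbar a μ x : ℝ) : EReal) else ⊥

/-! Finite-server (GRAND-F) objects. -/

/-- `X^□`. -/
def XBox (Kbar : S → Finset (I → ℕ)) (h : S → ℝ) : Set (S → (I → ℕ) → ℝ) :=
  {x | x ∈ orthK Kbar ∧ ∀ s, ∑ k ∈ Kc Kbar s, x s k ≤ h s}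

/-- `x_{0^s} = h_s − Σ_{k∈K^s} x_k`. -/
def x0 (Kbar : S → Finset (I → ℕ)) (h : S → ℝ) (x : S → (I → ℕ) → ℝ) (s : S) : ℝ :=
  h s - ∑ k ∈ Kc Kbar s, x s k

/-- `X^⋄ = X^□ ∩ X`. -/
def XDiamond (Kbar : S → Finset (I → ℕ)) (h : S → ℝ) (ρ : I → ℝ) :
    Set (S → (I → ℕ) → ℝ) := XBox Kbar h ∩ feasX Kbar ρ

/-- Assumption A: a feasible point with idle servers of every type. -/
def AssumptionA (Kbar : S → Finset (I → ℕ)) (h : S → ℝ) (ρ : I → ℝ) : Prop :=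
  ∃ x ∈ XDiamond Kbar h ρ, ∀ s, 0 < x0 Kbar h x s

/-- The function `L^□`. -/
def LBox (Kbar : S → Finset (I → ℕ)) (h : S → ℝ) (x : S → (I → ℕ) → ℝ) : ℝ :=
  ∑ s, (x0 Kbar h x s * Real.log (x0 Kbar h x s / Real.exp 1)
    + ∑ k ∈ Kc Kbar s, x s k * Real.log (x s k * ck k / Real.exp 1))

/-- Product form (finite-server system), including the zero configurations. -/
def prodFormBox (Kbar : S → Finset (I → ℕ)) (h : S → ℝ) (x : S → (I → ℕ) → ℝ)
    (ν : I → ℝ) (β : S → ℝ) : Prop :=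
  ∀ s, x0 Kbar h x s = Real.exp (-β s) ∧
    ∀ k ∈ Kc Kbar s, x s k = Real.exp (-β s) / ck k * Real.exp (∑ i, (k i : ℝ) * ν i)

/-- Extended coordinate value for the finite-server system. -/
def xvalBox (Kbar : S → Finset (I → ℕ)) (h : S → ℝ) (x : S → (I → ℕ) → ℝ)
    (s : S) (k : I → ℕ) : ℝ :=
  if k = 0 then x0 Kbar h x s else x s k

/-- `x_{(i)}` for the finite-server system (zero configurations included). -/
def xavailBox (Kbar : S → Finset (I → ℕ)) (h : S → ℝ) (x : S → (I → ℕ) → ℝ)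
    (i : I) : ℝ :=
  ∑ s, ((if econf i ∈ Kc Kbar s then x0 Kbar h x s else 0)
    + ∑ k ∈ (Kc Kbar s).filter (fun k => k + econf i ∈ Kbar s), x s k)

/-- Arrival rate `v_{k i}` (GRAND-F), with `λ_i = μ_i ρ_i`. -/
def vrateBox (Kbar : S → Finset (I → ℕ)) (h : S → ℝ) (μ ρ : I → ℝ)
    (x : S → (I → ℕ) → ℝ) (s : S) (k : I → ℕ) (i : I) : ℝ :=
  μ i * ρ i * xvalBox Kbar h x s (k - econf i) / xavailBox Kbar h x i

/-- The GRAND-F fluid vector field `F^□_k(x)`, for `k ∈ K^s`. -/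
def FdriftBox (Kbar : S → Finset (I → ℕ)) (h : S → ℝ) (μ ρ : I → ℝ)
    (x : S → (I → ℕ) → ℝ) (s : S) (k : I → ℕ) : ℝ :=
  (∑ i ∈ Finset.univ.filter (fun i : I => 1 ≤ k i ∧ k - econf i ∈ Kbar s),
    (vrateBox Kbar h μ ρ x s k i - wrate μ x s k i))
  - ∑ i ∈ Finset.univ.filter (fun i : I => k + econf i ∈ Kbar s),
    (vrateBox Kbar h μ ρ x s (k + econf i) i - wrate μ x s (k + econf i) i)

/-- The function `Ξ^□(x̄)`. -/
def XiBox (Kbar : S → Finset (I → ℕ)) (h : S → ℝ) (μ : I → ℝ)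
    (x : S → (I → ℕ) → ℝ) : ℝ :=
  ∑ i : I, ∑ s : S,
    ∑ k ∈ (Kc Kbar s).filter (fun k => 1 ≤ k i ∧ k - econf i ∈ Kbar s),
      ∑ s' : S,
        ∑ k' ∈ (Kc Kbar s').filter (fun k' => 1 ≤ k' i ∧ k' - econf i ∈ Kbar s'),
          (Real.log ((k' i : ℝ) * xvalBox Kbar h x s (k - econf i) * x s' k')
            - Real.log ((k i : ℝ) * x s k * xvalBox Kbar h x s' (k' - econf i)))
          * ((k i : ℝ) * μ i * x s k * xvalBox Kbar h x s' (k' - econf i)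
              / xavailBox Kbar h x i)

/-- The pairs `(s, k)` with `k ∈ K^s` from which a type-`i` customer can depart. -/
def departConf (Kbar : S → Finset (I → ℕ)) (i : I) : Finset (Σ _ : S, I → ℕ) :=
  Finset.univ.sigma fun s => (Kc Kbar s).filter fun k => 1 ≤ k i ∧ k - econf i ∈ Kbar s

/-- The rate `k_i x_k x_{k' - e_i}` of moving a type-`i` customer from `p` to form `q`,
up to the factor `μ_i / x_{(i)}`. -/
def moveRate (a : S → ℝ) (x : S → (I → ℕ) → ℝ) (i : I) (p q : Σ _ : S, I → ℕ) : ℝ :=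
  (p.2 i : ℝ) * x p.1 p.2 * xval a x q.1 (q.2 - econf i)

/-- The symmetric summand of `Ξ`. -/
def rateGap (a : S → ℝ) (x : S → (I → ℕ) → ℝ) (i : I) (p q : Σ _ : S, I → ℕ) : ℝ :=
  (Real.log (moveRate a x i q p) - Real.log (moveRate a x i p q)) *
    (moveRate a x i p q - moveRate a x i q p)

theorem mem_departConf {Kbar : S → Finset (I → ℕ)} {i : I} {p : Σ _ : S, I → ℕ} :
    p ∈ departConf Kbar i ↔
      p.2 ∈ Kc Kbar p.1 ∧ 1 ≤ p.2 i ∧ p.2 - econf i ∈ Kbar p.1 := by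
  simp [departConf]

theorem mem_departConf_of_mono {Kbar : S → Finset (I → ℕ)} (hmono : KbarMono Kbar) {i : I}
    {s : S} {k : I → ℕ} (hk : k ∈ Kc Kbar s) (hi : 1 ≤ k i) :
    (⟨s, k⟩ : Σ _ : S, I → ℕ) ∈ departConf Kbar i :=
  mem_departConf.2 ⟨hk, hi, hmono s k (Finset.mem_of_mem_erase hk) _ fun _ => Nat.sub_le _ _⟩

theorem econf_ne_zero (i : I) : econf i ≠ 0 := by
  simp [econf]

theorem econf_mem_Kc {Kbar : S → Finset (I → ℕ)} {i : I} {s : S} (h : econf i ∈ Kbar s) :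
    econf i ∈ Kc Kbar s :=
  Finset.mem_erase.2 ⟨econf_ne_zero i, h⟩

theorem Xi_eq_sum_rateGap (Kbar : S → Finset (I → ℕ)) (a : S → ℝ) (μ : I → ℝ)
    (x : S → (I → ℕ) → ℝ) :
    Xi Kbar a μ x = ∑ i, μ i / (2 * xavail Kbar a x i) *
      ∑ p ∈ departConf Kbar i, ∑ q ∈ departConf Kbar i, rateGap a x i p q := by
  unfold Xi
  refine Finset.sum_congr rfl fun i _ => ?_
  set f : (Σ _ : S, I → ℕ) → (Σ _ : S, I → ℕ) → ℝ := fun p q =>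
    (Real.log (moveRate a x i q p) - Real.log (moveRate a x i p q)) * moveRate a x i p q with hf
  have hgap : ∑ p ∈ departConf Kbar i, ∑ q ∈ departConf Kbar i, rateGap a x i p q
      = 2 * ∑ p ∈ departConf Kbar i, ∑ q ∈ departConf Kbar i, f p q := by
    have hswap : ∑ p ∈ departConf Kbar i, ∑ q ∈ departConf Kbar i, f q p
        = ∑ p ∈ departConf Kbar i, ∑ q ∈ departConf Kbar i, f p q := Finset.sum_comm
    rw [two_mul]
    nth_rewrite 2 [← hswap]
    simp only [← Finset.sum_add_distrib]
    refine Finset.sum_congr rfl fun p _ => Finset.sum_congr rfl fun q _ => ?_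
    simp only [rateGap, hf]
    ring
  have hscale : μ i / (2 * xavail Kbar a x i) *
      (2 * ∑ p ∈ departConf Kbar i, ∑ q ∈ departConf Kbar i, f p q)
      = ∑ p ∈ departConf Kbar i, ∑ q ∈ departConf Kbar i,
        f p q * (μ i / xavail Kbar a x i) := by
    simp only [← Finset.sum_mul]
    rw [mul_comm 2 (xavail _ _ _ _), ← div_div]
    ring
  rw [hgap, hscale]
  simp only [departConf, Finset.sum_sigma]
  refine Finset.sum_congr rfl fun s _ => Finset.sum_congr rfl fun k _ =>
    Finset.sum_congr rfl fun s' _ => Finset.sum_congr rfl fun k' _ => ?_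
  simp only [hf, moveRate]
  rw [mul_right_comm (k' i : ℝ) (xval _ _ _ _)]
  ring

theorem log_sub_log_mul_sub_nonpos {u v : ℝ} (hu : 0 < u) (hv : 0 < v) :
    (Real.log v - Real.log u) * (u - v) ≤ 0 := by
  rcases le_total u v with h | h
  · exact mul_nonpos_of_nonneg_of_nonpos (sub_nonneg.2 (Real.log_le_log hu h)) (sub_nonpos.2 h)
  · exact mul_nonpos_of_nonpos_of_nonneg (sub_nonpos.2 (Real.log_le_log hv h)) (sub_nonneg.2 h)

theorem eq_of_log_sub_log_mul_sub_nonneg {u v : ℝ} (hu : 0 < u) (hv : 0 < v)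
    (h : 0 ≤ (Real.log v - Real.log u) * (u - v)) : u = v := by
  rcases lt_trichotomy u v with huv | huv | huv
  · have := mul_neg_of_pos_of_neg (sub_pos.2 (Real.log_lt_log hu huv)) (sub_neg.2 huv)
    linarith
  · exact huv
  · have := mul_neg_of_neg_of_pos (sub_neg.2 (Real.log_lt_log hv huv)) (sub_pos.2 huv)
    linarith

theorem Finset.sum_le_of_mem_of_nonpos {ι : Type*} {s : Finset ι} {f : ι → ℝ}
    (hf : ∀ j ∈ s, f j ≤ 0) {j : ι} (hj : j ∈ s) : ∑ j ∈ s, f j ≤ f j := by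
  have := Finset.single_le_sum (f := fun j => -f j) (fun j hj => neg_nonneg.2 (hf j hj)) hj
  rw [Finset.sum_neg_distrib] at this
  linarith

theorem xval_pos {Kbar : S → Finset (I → ℕ)} {a : S → ℝ} (hapos : ∀ s, 0 < a s)
    {x : S → (I → ℕ) → ℝ} (hx : ∀ s, ∀ k ∈ Kc Kbar s, 0 < x s k) {s : S} {k : I → ℕ}
    (hk : k ∈ Kbar s) : 0 < xval a x s k := by
  unfold xval
  split_ifs with h
  · exact hapos s
  · exact hx s k (Finset.mem_erase.2 ⟨h, hk⟩)

theorem xavail_pos {Kbar : S → Finset (I → ℕ)} (hserve : KbarServe Kbar) {a : S → ℝ}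
    (hapos : ∀ s, 0 < a s) {x : S → (I → ℕ) → ℝ} (hx : ∀ s k, 0 ≤ x s k) (i : I) :
    0 < xavail Kbar a x i := by
  obtain ⟨s, hs⟩ := hserve i
  have hsum (t : S) : 0 ≤ ∑ k ∈ (Kc Kbar t).filter (fun k => k + econf i ∈ Kbar t), x t k :=
    Finset.sum_nonneg fun k _ => hx t k
  refine Finset.sum_pos' (fun t _ => add_nonneg ?_ (hsum t)) ⟨s, Finset.mem_univ s, ?_⟩
  · split_ifs
    exacts [(hapos t).le, le_rfl]
  · rw [if_pos (econf_mem_Kc hs)]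
    exact add_pos_of_pos_of_nonneg (hapos s) (hsum s)

theorem moveRate_pos {Kbar : S → Finset (I → ℕ)} {a : S → ℝ} (hapos : ∀ s, 0 < a s)
    {x : S → (I → ℕ) → ℝ} (hx : ∀ s, ∀ k ∈ Kc Kbar s, 0 < x s k) {i : I}
    {p q : Σ _ : S, I → ℕ} (hp : p ∈ departConf Kbar i) (hq : q ∈ departConf Kbar i) :
    0 < moveRate a x i p q := by
  obtain ⟨hpK, hpi, -⟩ := mem_departConf.1 hp
  obtain ⟨-, -, hq'⟩ := mem_departConf.1 hq
  exact mul_pos (mul_pos (by exact_mod_cast hpi) (hx _ _ hpK)) (xval_pos hapos hx hq')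

theorem rateGap_nonpos {Kbar : S → Finset (I → ℕ)} {a : S → ℝ} (hapos : ∀ s, 0 < a s)
    {x : S → (I → ℕ) → ℝ} (hx : ∀ s, ∀ k ∈ Kc Kbar s, 0 < x s k) {i : I}
    {p q : Σ _ : S, I → ℕ} (hp : p ∈ departConf Kbar i) (hq : q ∈ departConf Kbar i) :
    rateGap a x i p q ≤ 0 :=
  log_sub_log_mul_sub_nonpos (moveRate_pos hapos hx hp hq) (moveRate_pos hapos hx hq hp)

section Sign

variable {Kbar : S → Finset (I → ℕ)} {a : S → ℝ} {μ : I → ℝ} {x : S → (I → ℕ) → ℝ}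

theorem Xi_term_nonpos (hserve : KbarServe Kbar) (hapos : ∀ s, 0 < a s) (hμpos : ∀ i, 0 < μ i)
    (hx0 : ∀ s k, 0 ≤ x s k) (hx : ∀ s, ∀ k ∈ Kc Kbar s, 0 < x s k) (i : I) :
    μ i / (2 * xavail Kbar a x i) *
      ∑ p ∈ departConf Kbar i, ∑ q ∈ departConf Kbar i, rateGap a x i p q ≤ 0 :=
  mul_nonpos_of_nonneg_of_nonpos
    (div_pos (hμpos i) (mul_pos two_pos (xavail_pos hserve hapos hx0 i))).le
    (Finset.sum_nonpos fun _ hp => Finset.sum_nonpos fun _ hq => rateGap_nonpos hapos hx hp hq)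

theorem Xi_nonpos (hserve : KbarServe Kbar) (hapos : ∀ s, 0 < a s) (hμpos : ∀ i, 0 < μ i)
    (hx0 : ∀ s k, 0 ≤ x s k) (hx : ∀ s, ∀ k ∈ Kc Kbar s, 0 < x s k) : Xi Kbar a μ x ≤ 0 := by
  rw [Xi_eq_sum_rateGap]
  exact Finset.sum_nonpos fun i _ => Xi_term_nonpos hserve hapos hμpos hx0 hx i

theorem Xi_le_rateGap (hserve : KbarServe Kbar) (hapos : ∀ s, 0 < a s) (hμpos : ∀ i, 0 < μ i)
    (hx0 : ∀ s k, 0 ≤ x s k) (hx : ∀ s, ∀ k ∈ Kc Kbar s, 0 < x s k) {i : I}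
    {p q : Σ _ : S, I → ℕ} (hp : p ∈ departConf Kbar i) (hq : q ∈ departConf Kbar i) :
    Xi Kbar a μ x ≤ μ i / (2 * xavail Kbar a x i) * rateGap a x i p q := by
  rw [Xi_eq_sum_rateGap]
  refine (Finset.sum_le_of_mem_of_nonpos
    (fun j _ => Xi_term_nonpos hserve hapos hμpos hx0 hx j) (Finset.mem_univ i)).trans ?_
  refine mul_le_mul_of_nonneg_left ?_
    (div_pos (hμpos i) (mul_pos two_pos (xavail_pos hserve hapos hx0 i))).le
  refine (Finset.sum_le_of_mem_of_nonpos (fun _ hp' => Finset.sum_nonpos fun _ hq' =>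
    rateGap_nonpos hapos hx hp' hq') hp).trans ?_
  exact Finset.sum_le_of_mem_of_nonpos (fun _ hq' => rateGap_nonpos hapos hx hp hq') hq

theorem moveRate_comm_of_Xi_nonneg (hserve : KbarServe Kbar) (hapos : ∀ s, 0 < a s)
    (hμpos : ∀ i, 0 < μ i) (hx0 : ∀ s k, 0 ≤ x s k) (hx : ∀ s, ∀ k ∈ Kc Kbar s, 0 < x s k)
    (hXi : 0 ≤ Xi Kbar a μ x) {i : I} {p q : Σ _ : S, I → ℕ} (hp : p ∈ departConf Kbar i)
    (hq : q ∈ departConf Kbar i) : moveRate a x i p q = moveRate a x i q p :=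
  eq_of_log_sub_log_mul_sub_nonneg (moveRate_pos hapos hx hp hq) (moveRate_pos hapos hx hq hp)
    (nonneg_of_mul_nonneg_right (hXi.trans (Xi_le_rateGap hserve hapos hμpos hx0 hx hp hq))
      (div_pos (hμpos i) (mul_pos two_pos (xavail_pos hserve hapos hx0 i))))

end Sign

theorem ck_pos (k : I → ℕ) : 0 < ck k :=
  Finset.prod_pos fun i _ => by exact_mod_cast Nat.factorial_pos (k i)

theorem ck_add_econf (k : I → ℕ) (i : I) : ck (k + econf i) = ((k i : ℝ) + 1) * ck k := by
  unfold ck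
  rw [← Finset.mul_prod_erase _ _ (Finset.mem_univ i),
    ← Finset.mul_prod_erase Finset.univ (fun j => ((k j).factorial : ℝ)) (Finset.mem_univ i),
    Finset.prod_congr rfl (g := fun j => ((k j).factorial : ℝ))]
  · simp [econf, Nat.factorial_succ, mul_assoc]
  · intro j hj
    simp [econf, Finset.ne_of_mem_erase hj]

theorem sum_add_econf_mul (k : I → ℕ) (i : I) (ν : I → ℝ) :
    ∑ j, ((k + econf i) j : ℝ) * ν j = ∑ j, (k j : ℝ) * ν j + ν i := by
  simp [econf, add_mul, Finset.sum_add_distrib, Pi.single_apply]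

theorem sub_econf_add_econf {k : I → ℕ} {i : I} (hi : 1 ≤ k i) :
    k - econf i + econf i = k := by
  ext j
  by_cases h : j = i
  · subst h
    simp [econf, Nat.sub_add_cancel hi]
  · simp [econf, h]

/-- Detailed balance forces the product form. -/
theorem exists_prodForm_of_moveRate_comm {Kbar : S → Finset (I → ℕ)} (hmono : KbarMono Kbar)
    (hserve : KbarServe Kbar) {a : S → ℝ} (hapos : ∀ s, 0 < a s)
    {x : S → (I → ℕ) → ℝ} (hx : ∀ s, ∀ k ∈ Kc Kbar s, 0 < x s k)
    (hcomm : ∀ i, ∀ p ∈ departConf Kbar i, ∀ q ∈ departConf Kbar i,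
      moveRate a x i p q = moveRate a x i q p) :
    ∃ ν, prodForm Kbar a x ν := by
  choose σ hσ using hserve
  set ν : I → ℝ := fun i => Real.log (x (σ i) (econf i) / a (σ i)) with hν
  have hexp (i : I) : Real.exp (ν i) = x (σ i) (econf i) / a (σ i) :=
    Real.exp_log (div_pos (hx _ _ (econf_mem_Kc (hσ i))) (hapos _))
  have step (n : ℕ) : ∀ s, ∀ k ∈ Kbar s, ∑ i, k i = n →
      xval a x s k = a s / ck k * Real.exp (∑ i, (k i : ℝ) * ν i) := by
    induction n with
    | zero =>
      intro s k _ hsum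
      have hk0 : k = 0 := by
        ext i
        exact Finset.sum_eq_zero_iff.1 hsum i (Finset.mem_univ i)
      subst hk0
      simp [xval, ck]
    | succ n ih =>
      intro s k hk hsum
      obtain ⟨i, -, hi⟩ := Finset.exists_ne_zero_of_sum_ne_zero (by omega : ∑ i, k i ≠ 0)
      have hi : 1 ≤ k i := by omega
      obtain ⟨m, rfl⟩ : ∃ m, k = m + econf i := ⟨_, (sub_econf_add_econf hi).symm⟩
      have hne : m + econf i ≠ 0 := fun h => by
        have := congrFun h i
        simp [econf] at this
      have hsum' : ∑ j, m j = n := by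
        have : ∑ j, (m + econf i) j = ∑ j, m j + 1 := by
          simp [econf, Finset.sum_add_distrib]
        omega
      have hm := ih s m (hmono s _ hk m fun j => Nat.le_add_right _ _) hsum'
      have hbal := hcomm i _ (mem_departConf_of_mono hmono (Finset.mem_erase.2 ⟨hne, hk⟩) hi)
        _ (mem_departConf_of_mono hmono (econf_mem_Kc (hσ i)) (by simp [econf]))
      have hcast : ((m + econf i) i : ℝ) = m i + 1 := by simp [econf]
      have hone : (econf i i : ℝ) = 1 := by simp [econf]
      have hmi : (0 : ℝ) < m i + 1 := by positivity
      simp only [moveRate, add_tsub_cancel_right, tsub_self, hcast, hone] at hbal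
      rw [hm] at hbal
      have hx' : xval a x s (m + econf i) = x s (m + econf i) := if_neg hne
      have h0 : xval a x (σ i) 0 = a (σ i) := if_pos rfl
      rw [h0] at hbal
      rw [hx', ck_add_econf, sum_add_econf_mul, Real.exp_add, hexp]
      have := ck_pos m
      have := hapos (σ i)
      field_simp at hbal ⊢
      linarith
  refine ⟨ν, fun s k hk => ?_⟩
  rw [← step _ s k (Finset.mem_of_mem_erase hk) rfl, xval, if_neg (Finset.ne_of_mem_erase hk)]

theorem mul_log_sub_mul_log_ge {b x y : ℝ} (hb : 0 < b) (hx : 0 < x) (hy : 0 ≤ y) :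
    (y - x) * Real.log (x * (b * Real.exp 1)) ≤
      y * Real.log (y * b) - x * Real.log (x * b) := by
  rw [← mul_assoc, Real.log_mul (by positivity) (Real.exp_pos 1).ne', Real.log_exp,
    Real.log_mul hx.ne' hb.ne']
  rcases hy.eq_or_lt with rfl | hy
  · simp only [zero_sub, zero_mul]
    linarith
  · rw [Real.log_mul hy.ne' hb.ne']
    have h := Real.log_le_sub_one_of_pos (div_pos hx hy)
    rw [Real.log_div hx.ne' hy.ne'] at h
    have h' := mul_le_mul_of_nonneg_left h hy.le
    have h'' : y * (x / y - 1) = x - y := by field_simp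
    linarith

theorem Lfun_le_of_prodForm {Kbar : S → Finset (I → ℕ)} {ρ : I → ℝ} {a : S → ℝ}
    (hapos : ∀ s, 0 < a s) {x y : S → (I → ℕ) → ℝ} {ν : I → ℝ} (hx : x ∈ feasX Kbar ρ)
    (hy : y ∈ feasX Kbar ρ) (hpos : ∀ s, ∀ k ∈ Kc Kbar s, 0 < x s k)
    (hν : prodForm Kbar a x ν) : Lfun Kbar a x ≤ Lfun Kbar a y := by
  have hlin : ∑ s, ∑ k ∈ Kc Kbar s, (y s k - x s k) * ∑ i, (k i : ℝ) * ν i = 0 := by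
    have (z : S → (I → ℕ) → ℝ) (hz : z ∈ feasX Kbar ρ) :
        ∑ s, ∑ k ∈ Kc Kbar s, z s k * ∑ i, (k i : ℝ) * ν i = ∑ i, ρ i * ν i := by
      simp only [← hz.2, Finset.sum_mul, Finset.mul_sum]
      rw [Finset.sum_comm]
      refine Finset.sum_congr rfl fun s _ => ?_
      rw [Finset.sum_comm]
      exact Finset.sum_congr rfl fun i _ => Finset.sum_congr rfl fun k _ => by ring
    simp only [sub_mul, Finset.sum_sub_distrib]
    rw [this y hy, this x hx, sub_self]
  rw [← sub_nonneg, ← hlin]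
  unfold Lfun
  simp only [← Finset.sum_sub_distrib]
  refine Finset.sum_le_sum fun s _ => Finset.sum_le_sum fun k hk => ?_
  have hc := ck_pos k
  have ha := hapos s
  have h := mul_log_sub_mul_log_ge (b := ck k / (Real.exp 1 * a s)) (by positivity)
    (hpos s k hk) (hy.1.1 s k)
  have hlog : Real.log (x s k * (ck k / (Real.exp 1 * a s) * Real.exp 1))
      = ∑ i, (k i : ℝ) * ν i := by
    rw [← Real.log_exp (∑ i, (k i : ℝ) * ν i)]
    congr 1
    rw [hν s k hk]
    field_simp
  rw [hlog] at h
  simpa only [mul_div_assoc] using h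

theorem continuous_Lfun (Kbar : S → Finset (I → ℕ)) {a : S → ℝ} (hapos : ∀ s, 0 < a s) :
    Continuous (Lfun Kbar a) := by
  unfold Lfun
  refine continuous_finsetSum _ fun s _ => continuous_finsetSum _ fun k _ => ?_
  have hb : ck k / (Real.exp 1 * a s) ≠ 0 :=
    (div_pos (ck_pos k) (mul_pos (Real.exp_pos 1) (hapos s))).ne'
  have hcoord : Continuous fun x : S → (I → ℕ) → ℝ => x s k * (ck k / (Real.exp 1 * a s)) := by
    fun_prop
  have h := (Real.continuous_mul_log.comp hcoord).mul_const (ck k / (Real.exp 1 * a s))⁻¹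
  refine h.congr fun x => ?_
  simp only [Function.comp_apply, mul_div_assoc]
  rw [mul_right_comm, mul_assoc (x s k), mul_inv_cancel₀ hb, mul_one]

theorem exists_one_le_of_mem_Kc {Kbar : S → Finset (I → ℕ)} {s : S} {k : I → ℕ}
    (hk : k ∈ Kc Kbar s) : ∃ i, 1 ≤ k i := by
  obtain ⟨i, hi⟩ := Function.ne_iff.1 (Finset.ne_of_mem_erase hk)
  exact ⟨i, Nat.one_le_iff_ne_zero.2 hi⟩

theorem isCompact_feasX (Kbar : S → Finset (I → ℕ)) (ρ : I → ℝ) :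
    IsCompact (feasX Kbar ρ) := by
  refine (isCompact_univ_pi fun s => isCompact_univ_pi fun k =>
    isCompact_Icc (a := (0 : ℝ)) (b := ∑ i, |ρ i|)).of_isClosed_subset ?_ ?_
  · simp only [feasX, orthK, Set.ofPred_and, Set.ofPred_forall]
    refine ((isClosed_iInter fun s => isClosed_iInter fun k => ?_).inter
      (isClosed_iInter fun s => isClosed_iInter fun k => isClosed_iInter fun _ => ?_)).inter
      (isClosed_iInter fun i => ?_)
    · exact isClosed_le (by fun_prop) (by fun_prop)
    · exact isClosed_eq (by fun_prop) (by fun_prop)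
    · exact isClosed_eq (by fun_prop) (by fun_prop)
  · rintro x ⟨⟨hx0, hxK⟩, hxρ⟩ s - k -
    refine ⟨hx0 s k, ?_⟩
    by_cases hk : k ∈ Kc Kbar s
    · obtain ⟨i, hi⟩ := exists_one_le_of_mem_Kc hk
      have hnn (t : S) (l : I → ℕ) : 0 ≤ (l i : ℝ) * x t l :=
        mul_nonneg (Nat.cast_nonneg _) (hx0 t l)
      calc x s k ≤ (k i : ℝ) * x s k :=
            le_mul_of_one_le_left (hx0 s k) (by exact_mod_cast hi)
        _ ≤ ∑ l ∈ Kc Kbar s, (l i : ℝ) * x s l :=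
            Finset.single_le_sum (f := fun l => (l i : ℝ) * x s l) (fun l _ => hnn s l) hk
        _ ≤ ∑ t, ∑ l ∈ Kc Kbar t, (l i : ℝ) * x t l :=
            Finset.single_le_sum (f := fun t => ∑ l ∈ Kc Kbar t, (l i : ℝ) * x t l)
              (fun t _ => Finset.sum_nonneg fun l _ => hnn t l) (Finset.mem_univ s)
        _ = ρ i := hxρ i
        _ ≤ |ρ i| := le_abs_self _
        _ ≤ ∑ i, |ρ i| :=
            Finset.single_le_sum (f := fun i => |ρ i|) (fun i _ => abs_nonneg _)
              (Finset.mem_univ i)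
    · rw [hxK s k hk]
      exact Finset.sum_nonneg fun i _ => abs_nonneg _

theorem continuous_xval (a : S → ℝ) (s : S) (k : I → ℕ) :
    Continuous fun x : S → (I → ℕ) → ℝ => xval a x s k := by
  unfold xval
  split_ifs <;> fun_prop

theorem continuous_xavail (Kbar : S → Finset (I → ℕ)) (a : S → ℝ) (i : I) :
    Continuous fun x : S → (I → ℕ) → ℝ => xavail Kbar a x i := by
  unfold xavail
  fun_prop

theorem continuous_moveRate (a : S → ℝ) (i : I) (p q : Σ _ : S, I → ℕ) :
    Continuous fun x : S → (I → ℕ) → ℝ => moveRate a x i p q := by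
  have := continuous_xval a q.1 (q.2 - econf i)
  unfold moveRate
  fun_prop

theorem continuousAt_Xi {Kbar : S → Finset (I → ℕ)} (hserve : KbarServe Kbar) {a : S → ℝ}
    (hapos : ∀ s, 0 < a s) (μ : I → ℝ) {x : S → (I → ℕ) → ℝ} (hx0 : ∀ s k, 0 ≤ x s k)
    (hx : ∀ s, ∀ k ∈ Kc Kbar s, 0 < x s k) : ContinuousAt (Xi Kbar a μ) x := by
  rw [funext (Xi_eq_sum_rateGap Kbar a μ)]
  refine tendsto_finsetSum _ fun i _ => Tendsto.mul ?_ ?_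
  · exact continuousAt_const.div
      (continuousAt_const.mul (continuous_xavail Kbar a i).continuousAt)
      (mul_pos two_pos (xavail_pos hserve hapos hx0 i)).ne'
  · refine tendsto_finsetSum _ fun p hp => tendsto_finsetSum _ fun q hq => ?_
    have hpq := (continuous_moveRate a i p q).continuousAt (x := x)
    have hqp := (continuous_moveRate a i q p).continuousAt (x := x)
    exact ((hqp.log (moveRate_pos hapos hx hq hp).ne').sub
      (hpq.log (moveRate_pos hapos hx hp hq).ne')).mul (hpq.sub hqp)

/-- At a boundary point of `X`, some transition has zero rate while its reverse does not. -/
theorem exists_moveRate_eq_zero {Kbar : S → Finset (I → ℕ)} (hmono : KbarMono Kbar)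
    {ρ : I → ℝ} (hρpos : ∀ i, 0 < ρ i) {a : S → ℝ} (hapos : ∀ s, 0 < a s)
    {x : S → (I → ℕ) → ℝ} (hx : x ∈ feasX Kbar ρ)
    (hbd : ¬ ∀ s, ∀ k ∈ Kc Kbar s, 0 < x s k) :
    ∃ i, ∃ p ∈ departConf Kbar i, ∃ q ∈ departConf Kbar i,
      moveRate a x i p q = 0 ∧ 0 < moveRate a x i q p := by
  push Not at hbd
  obtain ⟨s, k₀, hk₀, hx₀⟩ := hbd
  obtain ⟨k, hk, hkmin⟩ := exists_minimal_le_of_wellFoundedLT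
    (fun k => k ∈ Kc Kbar s ∧ x s k ≤ 0) k₀ ⟨hk₀, hx₀⟩
  obtain ⟨i, hi⟩ := exists_one_le_of_mem_Kc hkmin.prop.1
  have hp := mem_departConf_of_mono hmono hkmin.prop.1 hi
  have hprev : 0 < xval a x s (k - econf i) := by
    unfold xval
    split_ifs with h
    · exact hapos s
    · by_contra! hle
      have hmem : k - econf i ∈ Kc Kbar s := Finset.mem_erase.2 ⟨h, (mem_departConf.1 hp).2.2⟩
      have := hkmin.le_of_le ⟨hmem, hle⟩ tsub_le_self i
      simp [econf] at this
      omega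
  obtain ⟨t, -, ht⟩ := Finset.exists_ne_zero_of_sum_ne_zero ((hx.2 i).trans_ne (hρpos i).ne')
  obtain ⟨l, hl, hlt⟩ := Finset.exists_ne_zero_of_sum_ne_zero ht
  have hli : l i ≠ 0 := fun h => hlt (by simp [h])
  have hxl : x t l ≠ 0 := fun h => hlt (by simp [h])
  refine ⟨i, _, hp, _, mem_departConf_of_mono hmono hl (Nat.one_le_iff_ne_zero.2 hli), ?_, ?_⟩
  · simp [moveRate, le_antisymm hkmin.prop.2 (hx.1.1 s k)]
  · exact mul_pos (mul_pos (by exact_mod_cast Nat.pos_of_ne_zero hli)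
      ((hx.1.1 t l).lt_of_ne' hxl)) hprev

theorem tendsto_XiE_bot {Kbar : S → Finset (I → ℕ)} (hmono : KbarMono Kbar)
    (hserve : KbarServe Kbar) {ρ : I → ℝ} (hρpos : ∀ i, 0 < ρ i) {a : S → ℝ}
    (hapos : ∀ s, 0 < a s) {μ : I → ℝ} (hμpos : ∀ i, 0 < μ i) {x : S → (I → ℕ) → ℝ}
    (hx : x ∈ feasX Kbar ρ) (hbd : ¬ ∀ s, ∀ k ∈ Kc Kbar s, 0 < x s k) :
    Tendsto (XiE Kbar a μ) (𝓝[feasX Kbar ρ] x) (𝓝 ⊥) := by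
  obtain ⟨i, p, hp, q, hq, hzero, hpos⟩ := exists_moveRate_eq_zero hmono hρpos hapos hx hbd
  set P : Set (S → (I → ℕ) → ℝ) := {y | ∀ s, ∀ k ∈ Kc Kbar s, 0 < y s k} with hP
  have hpq : Tendsto (fun y => moveRate a y i p q) (𝓝[feasX Kbar ρ ∩ P] x) (𝓝[>] 0) := by
    refine tendsto_nhdsWithin_iff.2 ⟨?_, ?_⟩
    · rw [← hzero]
      exact (continuous_moveRate a i p q).continuousAt.tendsto.mono_left nhdsWithin_le_nhds
    · filter_upwards [self_mem_nhdsWithin] with y hy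
      exact moveRate_pos hapos hy.2 hp hq
  have hqp : Tendsto (fun y => moveRate a y i q p) (𝓝[feasX Kbar ρ ∩ P] x)
      (𝓝 (moveRate a x i q p)) :=
    (continuous_moveRate a i q p).continuousAt.tendsto.mono_left nhdsWithin_le_nhds
  have hav : Tendsto (fun y => μ i / (2 * xavail Kbar a y i)) (𝓝[feasX Kbar ρ ∩ P] x)
      (𝓝 (μ i / (2 * xavail Kbar a x i))) :=
    (continuousAt_const.div (continuousAt_const.mul (continuous_xavail Kbar a i).continuousAt)
      (mul_pos two_pos (xavail_pos hserve hapos hx.1.1 i)).ne').tendsto.mono_left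
      nhdsWithin_le_nhds
  have hlog : Tendsto (fun y => Real.log (moveRate a y i q p) - Real.log (moveRate a y i p q))
      (𝓝[feasX Kbar ρ ∩ P] x) atTop := by
    simp only [sub_eq_add_neg]
    exact (hqp.log hpos.ne').add_atTop
      (tendsto_neg_atBot_atTop.comp (Real.tendsto_log_nhdsGT_zero.comp hpq))
  have hgap : Tendsto (fun y => μ i / (2 * xavail Kbar a y i) * rateGap a y i p q)
      (𝓝[feasX Kbar ρ ∩ P] x) atBot :=
    hav.pos_mul_atBot (div_pos (hμpos i) (mul_pos two_pos (xavail_pos hserve hapos hx.1.1 i)))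
      (hlog.atTop_mul_neg (by linarith)
        ((hpq.mono_right nhdsWithin_le_nhds).sub hqp))
  rw [EReal.tendsto_nhds_bot_iff_real]
  intro C
  have hev := mem_nhdsWithin_iff_eventually.1 (hgap.eventually_lt_atBot C)
  filter_upwards [eventually_nhdsWithin_of_eventually_nhds hev, self_mem_nhdsWithin] with y hy hyX
  unfold XiE
  split_ifs with h
  · exact_mod_cast (Xi_le_rateGap hserve hapos hμpos hyX.1.1 h hp hq).trans_lt (hy ⟨hyX, h⟩)
  · exact EReal.bot_lt_coe C

theorem continuousOn_XiE {Kbar : S → Finset (I → ℕ)} (hmono : KbarMono Kbar)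
    (hserve : KbarServe Kbar) {ρ : I → ℝ} (hρpos : ∀ i, 0 < ρ i) {a : S → ℝ}
    (hapos : ∀ s, 0 < a s) {μ : I → ℝ} (hμpos : ∀ i, 0 < μ i) :
    ContinuousOn (XiE Kbar a μ) (feasX Kbar ρ) := by
  intro x hx
  by_cases h : ∀ s, ∀ k ∈ Kc Kbar s, 0 < x s k
  · refine ContinuousAt.continuousWithinAt ?_
    refine (continuous_coe_real_ereal.continuousAt.comp
      (continuousAt_Xi hserve hapos μ hx.1.1 h)).congr ?_
    have hopen : ∀ᶠ y in 𝓝 x, ∀ s, ∀ k ∈ Kc Kbar s, 0 < y s k := by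
      refine eventually_all.2 fun s => (Finset.eventually_all _).2 fun k hk => ?_
      exact (show Continuous fun y : S → (I → ℕ) → ℝ => y s k by fun_prop).continuousAt.eventually
        (lt_mem_nhds (h s k hk))
    filter_upwards [hopen] with y hy
    exact (if_pos hy).symm
  · have hbot : XiE Kbar a μ x = ⊥ := if_neg h
    rw [ContinuousWithinAt, hbot]
    exact tendsto_XiE_bot hmono hserve hρpos hapos hμpos hx h

theorem XiE_nonpos {Kbar : S → Finset (I → ℕ)} (hserve : KbarServe Kbar) {a : S → ℝ}
    (hapos : ∀ s, 0 < a s) {μ : I → ℝ} (hμpos : ∀ i, 0 < μ i) {x : S → (I → ℕ) → ℝ}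
    (hx0 : ∀ s k, 0 ≤ x s k) : XiE Kbar a μ x ≤ 0 := by
  unfold XiE
  split_ifs with h
  · exact_mod_cast Xi_nonpos hserve hapos hμpos hx0 h
  · exact bot_le

/-- A point of `X` where `Ξ ≥ 0` minimizes `L^{(a)}` over `X`. -/
theorem Lfun_le_of_XiE_nonneg {Kbar : S → Finset (I → ℕ)} (hmono : KbarMono Kbar)
    (hserve : KbarServe Kbar) {ρ : I → ℝ} {a : S → ℝ} (hapos : ∀ s, 0 < a s) {μ : I → ℝ}
    (hμpos : ∀ i, 0 < μ i) {x y : S → (I → ℕ) → ℝ} (hx : x ∈ feasX Kbar ρ)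
    (hy : y ∈ feasX Kbar ρ) (hXi : 0 ≤ XiE Kbar a μ x) : Lfun Kbar a x ≤ Lfun Kbar a y := by
  unfold XiE at hXi
  split_ifs at hXi with h
  · have hXi : 0 ≤ Xi Kbar a μ x := by exact_mod_cast hXi
    obtain ⟨ν, hν⟩ := exists_prodForm_of_moveRate_comm hmono hserve hapos h
      fun i p hp q hq => moveRate_comm_of_Xi_nonneg hserve hapos hμpos hx.1.1 h hXi hp hq
    exact Lfun_le_of_prodForm hapos hx hy h hν
  · simp at hXi

/-- the extension of `Ξ` by `−∞` is continuous on `X` as a map into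
`[−∞,0] ⊆ EReal`; consequently `L^{(a)}(x) − L^{(a)}(x^{*,a}) ≥ δ₂` forces
`Ξ(x) ≤ −δ₃`. -/
theorem XiE_continuousOn_and_negative_away_from_minimizer
    (Kbar : S → Finset (I → ℕ))
    (hmono : KbarMono Kbar) (hzero : KbarZero Kbar) (hserve : KbarServe Kbar)
    (ρ : I → ℝ) (hρpos : ∀ i, 0 < ρ i) (hρsum : ∑ i, ρ i = 1)
    (a : S → ℝ) (hapos : ∀ s, 0 < a s)
    (μ : I → ℝ) (hμpos : ∀ i, 0 < μ i)
    (xstar : S → (I → ℕ) → ℝ) (hxstar : xstar ∈ feasX Kbar ρ)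
    (hmin : ∀ y ∈ feasX Kbar ρ, Lfun Kbar a xstar ≤ Lfun Kbar a y) :
    ContinuousOn (XiE Kbar a μ) (feasX Kbar ρ) ∧
    (∀ x ∈ feasX Kbar ρ, XiE Kbar a μ x ≤ (0 : EReal)) ∧
    ∀ δ₂ > (0 : ℝ), ∃ δ₃ > (0 : ℝ), ∀ x ∈ feasX Kbar ρ,
      δ₂ ≤ Lfun Kbar a x - Lfun Kbar a xstar →
      XiE Kbar a μ x ≤ ((-δ₃ : ℝ) : EReal) := by
  refine ⟨continuousOn_XiE hmono hserve hρpos hapos hμpos,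
    fun x hx => XiE_nonpos hserve hapos hμpos hx.1.1, fun δ₂ hδ₂ => ?_⟩
  set A := feasX Kbar ρ ∩ {x | δ₂ ≤ Lfun Kbar a x - Lfun Kbar a xstar} with hA
  have hcompact : IsCompact A := (isCompact_feasX Kbar ρ).inter_right
    (isClosed_le continuous_const ((continuous_Lfun Kbar hapos).sub continuous_const))
  rcases A.eq_empty_or_nonempty with hempty | hne
  · refine ⟨1, one_pos, fun x hx hL => ?_⟩
    exact absurd (show x ∈ A from ⟨hx, hL⟩) (by simp [hempty])
  obtain ⟨z, ⟨hz, hzL⟩, hzmax⟩ := hcompact.exists_isMaxOn hne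
    ((continuousOn_XiE hmono hserve hρpos hapos hμpos (a := a) (μ := μ)).mono
      Set.inter_subset_left)
  have hneg : XiE Kbar a μ z < 0 := by
    by_contra! hge
    have := Lfun_le_of_XiE_nonneg hmono hserve hapos hμpos hz hxstar hge
    have : δ₂ ≤ Lfun Kbar a z - Lfun Kbar a xstar := hzL
    linarith
  obtain ⟨c, hzc, hc⟩ := EReal.lt_iff_exists_real_btwn.1 hneg
  refine ⟨-c, neg_pos.2 (by exact_mod_cast hc), fun x hx hL => ?_⟩
  rw [neg_neg]
  exact (hzmax ⟨hx, hL⟩).trans hzc.le
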